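/- arXiv:2110.01027 — 2 statements merged into one kernel-verified Lean document; each statement's English description precedes it below -/
import Mathlib

section
/- Consider N agents, where agent i chooses actions in ℝ^{m_i}. For each i let c^i : ℝ^{m_1} × ⋯ × ℝ^{m_N} → ℝ be a nonnegative measurable cost function. Let π^1, …, π^N be probability densities, with π^i a probability density on ℝ^{m_i}, and for each i define the averaged cost c̄^i(a) = ∫ c^i(a^1, …, a^{i−1}, a, a^{i+1}, …, a^N) ∏_{j≠i} π^j(a^j) da^{−i} for a ∈ ℝ^{m_i}. Assume for every i that c̄^i(a) is finite for every a, that Z^i := ∫_{ℝ^{m_i}} exp(−c̄^i(a)) da is finite, and that a ↦ π^i(a) c̄^i(a) and a ↦ π^i(a) log π^i(a) are Lebesgue-integrable. Then the following are equivalent: (i) [Entropic Cost Equilibrium] for every i, π^i(a) = exp(−c̄^i(a)) / Z^i for almost every a ∈ ℝ^{m_i}; (ii) [mixed-strategy Nash equilibrium of the entropy-regularized game] for every i and every probability density f on ℝ^{m_i} such that f·c̄^i and f·log f are Lebesgue-integrable, ∫ c̄^i(a) π^i(a) da − H(π^i) ≤ ∫ c̄^i(a) f(a) da − H(f). -/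
open MeasureTheory Real

noncomputable section

/-- A probability density on `ℝ^m = EuclideanSpace ℝ (Fin m)` (with Lebesgue measure):
a measurable function `f` with `f ≥ 0` almost everywhere and `∫ f = 1`. -/
def IsProbDensity {m : ℕ} (f : EuclideanSpace ℝ (Fin m) → ℝ) : Prop :=
  Measurable f ∧ (∀ᵐ x, 0 ≤ f x) ∧ (∫ x, f x) = 1

/-- The differential entropy `H(f) = −∫ f log f` of a probability density
(with the convention `log 0 = 0`, which holds for `Real.log`). -/
def entropy {m : ℕ} (f : EuclideanSpace ℝ (Fin m) → ℝ) : ℝ :=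
  -∫ x, f x * Real.log (f x)

/-- The full action profile obtained by inserting action `a` of agent `i` into the profile
`rest` of actions of all the other agents. -/
def combine {N : ℕ} (m : Fin N → ℕ) (i : Fin N)
    (a : EuclideanSpace ℝ (Fin (m i)))
    (rest : ∀ j : {j : Fin N // j ≠ i}, EuclideanSpace ℝ (Fin (m j.1))) :
    ∀ j : Fin N, EuclideanSpace ℝ (Fin (m j)) :=
  fun j =>
    if h : j = i then cast (congrArg (fun k => EuclideanSpace ℝ (Fin (m k))) h.symm) a
    else rest ⟨j, h⟩

/-- The averaged cost of agent `i`: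
`c̄^i(a) = ∫ c^i(a^1, …, a^{i−1}, a, a^{i+1}, …, a^N) ∏_{j≠i} π^j(a^j) da^{−i}`. -/
def cbar {N : ℕ} (m : Fin N → ℕ)
    (c : ∀ _i : Fin N, (∀ j : Fin N, EuclideanSpace ℝ (Fin (m j))) → ℝ)
    (pol : ∀ j : Fin N, EuclideanSpace ℝ (Fin (m j)) → ℝ)
    (i : Fin N) (a : EuclideanSpace ℝ (Fin (m i))) : ℝ :=
  ∫ rest : ∀ j : {j : Fin N // j ≠ i}, EuclideanSpace ℝ (Fin (m j.1)),
    c i (combine m i a rest) * ∏ j : {j : Fin N // j ≠ i}, pol j.1 (rest j)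

section Gibbs

open Filter Topology

variable {α : Type*} [MeasurableSpace α] {μ : Measure α}

/-- The generalized Kullback–Leibler integrand of `t ≥ 0` against the Gibbs weight
`exp (-v) / Z`. -/
lemma gibbs_mul_klFun {t v Z : ℝ} (ht : 0 ≤ t) (hZ : 0 < Z) :
    exp (-v) / Z * InformationTheory.klFun (t / (exp (-v) / Z)) =
      t * v + t * log t + log Z * t - t + exp (-v) / Z := by
  have he := exp_pos (-v)
  have hq : 0 < exp (-v) / Z := div_pos he hZ
  rcases ht.eq_or_lt with rfl | ht
  · simp [InformationTheory.klFun]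
  · rw [InformationTheory.klFun, log_div ht.ne' hq.ne', log_div he.ne' hZ.ne', log_exp]
    field_simp
    ring

lemma gibbs_mul_klFun_nonneg {t v Z : ℝ} (ht : 0 ≤ t) (hZ : 0 < Z) :
    0 ≤ exp (-v) / Z * InformationTheory.klFun (t / (exp (-v) / Z)) :=
  mul_nonneg (by positivity) (InformationTheory.klFun_nonneg (by positivity))

lemma integrable_gibbs_mul_klFun {f V : α → ℝ} {Z : ℝ} (hf0 : 0 ≤ᵐ[μ] f) (hf : Integrable f μ)
    (hV : Integrable (fun a => exp (-V a)) μ) (hZ : 0 < Z)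
    (hfV : Integrable (fun a => f a * V a) μ) (hfl : Integrable (fun a => f a * log (f a)) μ) :
    Integrable (fun a => exp (-V a) / Z *
      InformationTheory.klFun (f a / (exp (-V a) / Z))) μ := by
  refine Integrable.congr
    ((((hfV.add hfl).add (hf.const_mul (log Z))).sub hf).add (hV.div_const Z)) ?_
  filter_upwards [hf0] with a ha
  simp [gibbs_mul_klFun ha hZ]

/-- The free energy of a density `f` exceeds `-log Z` by the relative entropy of `f` with respect
to the Gibbs density. -/
lemma free_energy_add_log_partition {f V : α → ℝ} (hf0 : 0 ≤ᵐ[μ] f) (hf : Integrable f μ)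
    (hf1 : ∫ a, f a ∂μ = 1)
    (hV : Integrable (fun a => exp (-V a)) μ) (hZ : 0 < ∫ a, exp (-V a) ∂μ)
    (hfV : Integrable (fun a => f a * V a) μ) (hfl : Integrable (fun a => f a * log (f a)) μ) :
    (∫ a, f a * V a ∂μ) + (∫ a, f a * log (f a) ∂μ) + log (∫ a, exp (-V a) ∂μ) =
      ∫ a, exp (-V a) / (∫ b, exp (-V b) ∂μ) *
        InformationTheory.klFun (f a / (exp (-V a) / ∫ b, exp (-V b) ∂μ)) ∂μ := by
  set Z := ∫ a, exp (-V a) ∂μ with hZdef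
  have h1 : ∫ a, exp (-V a) / Z * InformationTheory.klFun (f a / (exp (-V a) / Z)) ∂μ =
      ∫ a, (f a * V a + f a * log (f a) + log Z * f a - f a + exp (-V a) / Z) ∂μ := by
    refine integral_congr_ae ?_
    filter_upwards [hf0] with a ha using gibbs_mul_klFun ha hZ
  have h2 : Integrable (fun a => f a * V a + f a * log (f a)) μ := hfV.add hfl
  have h3 : Integrable (fun a => f a * V a + f a * log (f a) + log Z * f a) μ :=
    h2.add (hf.const_mul (log Z))
  have h4 : Integrable (fun a => f a * V a + f a * log (f a) + log Z * f a - f a) μ :=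
    h3.sub hf
  rw [h1, integral_add h4 (hV.div_const Z), integral_sub h3 hf,
    integral_add h2 (hf.const_mul (log Z)), integral_add hfV hfl, integral_const_mul, hf1,
    integral_div, ← hZdef, div_self hZ.ne']
  ring

/-- The Gibbs variational principle: the free energy is at least `-log Z`. -/
lemma neg_log_partition_le_free_energy {f V : α → ℝ} (hf0 : 0 ≤ᵐ[μ] f) (hf : Integrable f μ)
    (hf1 : ∫ a, f a ∂μ = 1)
    (hV : Integrable (fun a => exp (-V a)) μ) (hZ : 0 < ∫ a, exp (-V a) ∂μ)
    (hfV : Integrable (fun a => f a * V a) μ) (hfl : Integrable (fun a => f a * log (f a)) μ) :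
    -log (∫ a, exp (-V a) ∂μ) ≤ (∫ a, f a * V a ∂μ) + ∫ a, f a * log (f a) ∂μ := by
  have h := free_energy_add_log_partition hf0 hf hf1 hV hZ hfV hfl
  have h0 := integral_nonneg_of_ae (hf0.mono fun a ha => gibbs_mul_klFun_nonneg (v := V a) ha hZ)
  linarith

/-- The minimal free energy is attained exactly at the Gibbs density. -/
lemma free_energy_le_neg_log_partition_iff {f V : α → ℝ} (hf0 : 0 ≤ᵐ[μ] f) (hf : Integrable f μ)
    (hf1 : ∫ a, f a ∂μ = 1)
    (hV : Integrable (fun a => exp (-V a)) μ) (hZ : 0 < ∫ a, exp (-V a) ∂μ)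
    (hfV : Integrable (fun a => f a * V a) μ) (hfl : Integrable (fun a => f a * log (f a)) μ) :
    (∫ a, f a * V a ∂μ) + (∫ a, f a * log (f a) ∂μ) ≤ -log (∫ a, exp (-V a) ∂μ) ↔
      f =ᵐ[μ] fun a => exp (-V a) / ∫ b, exp (-V b) ∂μ := by
  have h := free_energy_add_log_partition hf0 hf hf1 hV hZ hfV hfl
  have hnn := hf0.mono fun a ha => gibbs_mul_klFun_nonneg (v := V a) ha hZ
  have h0 := integral_nonneg_of_ae hnn
  have hiff := integral_eq_zero_iff_of_nonneg_ae hnn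
    (integrable_gibbs_mul_klFun hf0 hf hV hZ hfV hfl)
  rw [← h] at hiff
  rw [← h] at h0
  refine (show _ ↔ _ from ⟨fun hle => le_antisymm (by linarith) h0, fun he => by linarith⟩).trans
    (hiff.trans ⟨fun hz => ?_, fun hz => ?_⟩)
  · filter_upwards [hz, hf0] with a ha ha0
    have hq : 0 < exp (-V a) / ∫ b, exp (-V b) ∂μ := div_pos (exp_pos _) hZ
    have hk := (mul_eq_zero.1 ha).resolve_left hq.ne'
    rw [InformationTheory.klFun_eq_zero_iff (div_nonneg ha0 hq.le)] at hk
    exact (div_eq_one_iff_eq hq.ne').1 hk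
  · filter_upwards [hz] with a ha
    have hq : 0 < exp (-V a) / ∫ b, exp (-V b) ∂μ := div_pos (exp_pos _) hZ
    simp only [ha, div_self hq.ne', InformationTheory.klFun_one, mul_zero, Pi.zero_apply]

/-- The Gibbs weight restricted to a set on which the potential is bounded, normalized, has free
energy `-log` of its normalization. -/
lemma truncated_gibbs {V : α → ℝ} (hVm : Measurable V) (hV : Integrable (fun a => exp (-V a)) μ)
    {r : ℝ} (hr : 0 < ∫ a in {a | |V a| ≤ r}, exp (-V a) ∂μ) :
    ∃ f : α → ℝ, Measurable f ∧ (∀ a, 0 ≤ f a) ∧ ∫ a, f a ∂μ = 1 ∧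
      Integrable (fun a => f a * V a) μ ∧ Integrable (fun a => f a * log (f a)) μ ∧
      (∫ a, f a * V a ∂μ) + ∫ a, f a * log (f a) ∂μ =
        -log (∫ a in {a | |V a| ≤ r}, exp (-V a) ∂μ) := by
  set S := {a | |V a| ≤ r}
  have hSm : MeasurableSet S := measurableSet_le (by fun_prop) measurable_const
  set Z := ∫ a in S, exp (-V a) ∂μ with hZ
  set f : α → ℝ := S.indicator fun a => exp (-V a) / Z with hf
  have hfm : Measurable f := Measurable.indicator (by fun_prop) hSm
  have hfi : Integrable f μ := (hV.div_const Z).indicator hSm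
  have hf1 : ∫ a, f a ∂μ = 1 := by
    rw [hf, integral_indicator hSm, integral_div, ← hZ, div_self hr.ne']
  have hfV : Integrable (fun a => f a * V a) μ := by
    refine (hfi.norm.mul_const r).mono' (hfm.mul hVm).aestronglyMeasurable (ae_of_all _ fun a => ?_)
    rw [norm_mul]
    by_cases ha : a ∈ S
    · exact mul_le_mul_of_nonneg_left ha (norm_nonneg _)
    · simp [hf, ha]
  have hlog : ∀ a, f a * log (f a) = -(f a * V a) - log Z * f a := fun a => by
    by_cases ha : a ∈ S
    · simp only [hf, Set.indicator_of_mem ha]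
      rw [log_div (exp_pos _).ne' hr.ne', log_exp]
      ring
    · simp [hf, ha]
  refine ⟨f, hfm, fun a => Set.indicator_nonneg (fun a _ => by positivity) a, hf1, hfV, ?_, ?_⟩
  · simp_rw [hlog]
    exact hfV.neg.sub (hfi.const_mul _)
  · simp_rw [hlog]
    rw [integral_sub hfV.fun_neg (hfi.const_mul _), integral_neg, integral_const_mul, hf1]
    ring

/-- A lower bound for the free energies of all densities is at most `-log Z`. The Gibbs density
itself may have infinite mean energy, so it is approximated by truncations. -/
lemma le_neg_log_partition {V : α → ℝ} (hVm : Measurable V)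
    (hV : Integrable (fun a => exp (-V a)) μ) (hZ : 0 < ∫ a, exp (-V a) ∂μ) {x : ℝ}
    (hx : ∀ f : α → ℝ, Measurable f → (∀ a, 0 ≤ f a) → ∫ a, f a ∂μ = 1 →
      Integrable (fun a => f a * V a) μ → Integrable (fun a => f a * log (f a)) μ →
      x ≤ (∫ a, f a * V a ∂μ) + ∫ a, f a * log (f a) ∂μ) :
    x ≤ -log (∫ a, exp (-V a) ∂μ) := by
  have hU : ⋃ n : ℕ, {a | |V a| ≤ n} = Set.univ :=
    Set.eq_univ_of_forall fun a => Set.mem_iUnion.2 (exists_nat_ge |V a|)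
  have ht : Tendsto (fun n : ℕ => ∫ a in {a | |V a| ≤ n}, exp (-V a) ∂μ) atTop
      (𝓝 (∫ a, exp (-V a) ∂μ)) := by
    have := tendsto_setIntegral_of_monotone (μ := μ) (f := fun a => exp (-V a))
      (s := fun n : ℕ => {a | |V a| ≤ n})
      (fun n => measurableSet_le (by fun_prop) measurable_const)
      (fun i j hij a ha => (show |V a| ≤ i from ha).trans (Nat.cast_le.2 hij)) hV.integrableOn
    rwa [hU, setIntegral_univ] at this
  refine ge_of_tendsto (ht.log hZ.ne').neg ?_
  filter_upwards [ht.eventually_const_lt hZ] with n hn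
  obtain ⟨f, hfm, hf0, hf1, hfV, hfl, he⟩ := truncated_gibbs hVm hV hn
  exact he ▸ hx f hfm hf0 hf1 hfV hfl

/-- A density minimizes the free energy if and only if it is the Gibbs density. -/
theorem ae_eq_gibbs_iff_free_energy_le [NeZero μ] {p V : α → ℝ} (hp0 : 0 ≤ᵐ[μ] p)
    (hp1 : ∫ a, p a ∂μ = 1) (hV : Integrable (fun a => exp (-V a)) μ)
    (hpV : Integrable (fun a => p a * V a) μ) (hpl : Integrable (fun a => p a * log (p a)) μ) :
    (p =ᵐ[μ] fun a => exp (-V a) / ∫ b, exp (-V b) ∂μ) ↔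
      ∀ f : α → ℝ, (Measurable f ∧ (∀ᵐ a ∂μ, 0 ≤ f a) ∧ ∫ a, f a ∂μ = 1) →
        Integrable (fun a => f a * V a) μ → Integrable (fun a => f a * log (f a)) μ →
        (∫ a, p a * V a ∂μ) + (∫ a, p a * log (p a) ∂μ) ≤
          (∫ a, f a * V a ∂μ) + ∫ a, f a * log (f a) ∂μ := by
  have integrable_of_one {f : α → ℝ} (h : ∫ a, f a ∂μ = 1) : Integrable f μ :=
    Integrable.of_integral_ne_zero (h ▸ one_ne_zero)
  have hZ : 0 < ∫ a, exp (-V a) ∂μ := integral_exp_pos hV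
  rw [← free_energy_le_neg_log_partition_iff hp0 (integrable_of_one hp1) hp1 hV hZ hpV hpl]
  constructor
  · rintro h f ⟨-, hf0, hf1⟩ hfV hfl
    exact h.trans
      (neg_log_partition_le_free_energy hf0 (integrable_of_one hf1) hf1 hV hZ hfV hfl)
  · intro h
    have hVm : AEMeasurable V μ := by
      simpa using hV.aestronglyMeasurable.aemeasurable.log.fun_neg
    obtain ⟨W, hWm, hVW⟩ := hVm
    have hexp : (fun a => exp (-V a)) =ᵐ[μ] fun a => exp (-W a) :=
      hVW.mono fun a ha => by simp only [ha]
    have hmul (f : α → ℝ) : (fun a => f a * V a) =ᵐ[μ] fun a => f a * W a :=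
      hVW.mono fun a ha => by simp only [ha]
    rw [integral_congr_ae hexp] at hZ ⊢
    refine le_neg_log_partition hWm (hV.congr hexp) hZ fun f hfm hf0 hf1 hfW hfl => ?_
    rw [← integral_congr_ae (hmul f)]
    exact h f ⟨hfm, ae_of_all _ hf0, hf1⟩ (hfW.congr (hmul f).symm) hfl

end Gibbs

/-- **Entropic Cost Equilibrium ⟺ Nash equilibrium of the entropy-regularized game
(one-stage case of Theorem 1).** Given `N` agents with nonnegative measurable costs `c^i`
on the joint action space and probability densities `π^1, …, π^N`, with averaged costs
`c̄^i` finite (the defining integrand being integrable for every `a`), partition functions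
`Z^i = ∫ exp(−c̄^i)` finite, and `π^i c̄^i`, `π^i log π^i` integrable, the following are
equivalent: (i) for every `i`, `π^i(a) = exp(−c̄^i(a)) / Z^i` for almost every `a`
(Entropic Cost Equilibrium); (ii) for every `i` and every probability density `f` on
`ℝ^{m_i}` with `f c̄^i` and `f log f` integrable,
`∫ c̄^i π^i − H(π^i) ≤ ∫ c̄^i f − H(f)` (mixed-strategy Nash equilibrium of the game with
costs `c^i` minus policy entropy). -/
theorem ECE_iff_nash_of_entropy_regularized_game {N : ℕ} (hN : 0 < N)
    (m : Fin N → ℕ) (hm : ∀ j, 0 < m j)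
    (c : ∀ _i : Fin N, (∀ j : Fin N, EuclideanSpace ℝ (Fin (m j))) → ℝ)
    (hcmeas : ∀ i, Measurable (c i)) (hcnonneg : ∀ i x, 0 ≤ c i x)
    (pol : ∀ j : Fin N, EuclideanSpace ℝ (Fin (m j)) → ℝ)
    (hpol : ∀ j, IsProbDensity (pol j))
    (hcbar_fin : ∀ (i : Fin N) (a : EuclideanSpace ℝ (Fin (m i))),
      Integrable (fun rest : ∀ j : {j : Fin N // j ≠ i}, EuclideanSpace ℝ (Fin (m j.1)) =>
        c i (combine m i a rest) * ∏ j : {j : Fin N // j ≠ i}, pol j.1 (rest j)))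
    (hZ_fin : ∀ i : Fin N, Integrable (fun a => Real.exp (-(cbar m c pol i a))))
    (hpol_cbar : ∀ i : Fin N, Integrable (fun a => pol i a * cbar m c pol i a))
    (hpol_log : ∀ i : Fin N, Integrable (fun a => pol i a * Real.log (pol i a))) :
    (∀ i : Fin N, pol i =ᵐ[volume] fun a =>
        Real.exp (-(cbar m c pol i a)) / (∫ x, Real.exp (-(cbar m c pol i x)))) ↔
    (∀ i : Fin N, ∀ f : EuclideanSpace ℝ (Fin (m i)) → ℝ, IsProbDensity f →
      Integrable (fun a => f a * cbar m c pol i a) →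
      Integrable (fun a => f a * Real.log (f a)) →
      (∫ a, cbar m c pol i a * pol i a) - entropy (pol i) ≤
        (∫ a, cbar m c pol i a * f a) - entropy f) := by
  refine forall_congr' fun i => ?_
  rw [ae_eq_gibbs_iff_free_energy_le (hpol i).2.1 (hpol i).2.2 (hZ_fin i) (hpol_cbar i)
    (hpol_log i)]
  simp only [IsProbDensity, entropy, sub_neg_eq_add, mul_comm (cbar m c pol i _)]
end
end

section
/- Fix positive integers n, N, an index i ∈ {1, …, N}, and a state s ∈ ℝ^n. Let A be a real n×n matrix and for each j let B^j be a real n×m_j matrix; let Z be a symmetric n×n real matrix, ξ ∈ ℝ^n, let R^{ii} be a symmetric m_i×m_i real matrix, and for j ≠ i let R^{ij} be a symmetric m_j×m_j real matrix. For each j ≠ i let ν^j be a probability measure on ℝ^{m_j} with mean μ^j and covariance Σ^j, and let ν_w be a probability measure on ℝ^n with mean 0 and covariance I_n. Define the averaged Q-function Q̄(a) = (1/2) aᵀ R^{ii} a + Σ_{j≠i} (1/2) ∫ a^{jᵀ} R^{ij} a^j dν^j(a^j) + ∫ ( (1/2) s'ᵀ Z s' + ξᵀ s' ) d( ⊗_{j≠i}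 ν^j ⊗ ν_w ), where s' = A s + B^i a + Σ_{j≠i} B^j a^j + w. Then there exists a constant C ∈ ℝ, independent of a, such that for all a ∈ ℝ^{m_i}: Q̄(a) = (1/2) aᵀ ( R^{ii} + B^{iᵀ} Z B^i ) a + bᵀ a + C, where b = B^{iᵀ} ( Z ( A s + Σ_{j≠i} B^j μ^j ) + ξ ). -/
open MeasureTheory Real Matrix

noncomputable section

/-- Conversion of a point of Euclidean space to a plain vector. -/
def ev {k : ℕ} (x : EuclideanSpace ℝ (Fin k)) : Fin k → ℝ := x

/-- A probability measure `ν` on `ℝ^n = EuclideanSpace ℝ (Fin n)` has mean `μ` and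
covariance `Σ`: the identity map is `ν`-integrable with `∫ x ∂ν = μ`, the squared norm is
`ν`-integrable, and `∫ (x−μ)(x−μ)ᵀ ∂ν = Σ` entrywise. -/
def HasMeanCov {n : ℕ} (ν : Measure (EuclideanSpace ℝ (Fin n)))
    (μ : EuclideanSpace ℝ (Fin n)) (S : Matrix (Fin n) (Fin n) ℝ) : Prop :=
  Integrable (fun x => x) ν ∧ (∫ x, x ∂ν) = μ ∧
  Integrable (fun x => ‖x‖ ^ 2) ν ∧
  ∀ i j, (∫ x, (x i - μ i) * (x j - μ j) ∂ν) = S i j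

/-- The expected linear-quadratic cost of a square-integrable random vector translated by `u` is
quadratic in `u`. -/
theorem integral_quadratic_translate {Ω ι : Type*} [MeasurableSpace Ω] [Fintype ι]
    (P : Measure Ω) [IsProbabilityMeasure P] (X : Ω → ι → ℝ)
    (hX : ∀ k, MemLp (fun ω => X ω k) 2 P)
    (Z : Matrix ι ι ℝ) (hZ : Z.IsSymm) (ξ u : ι → ℝ) :
    ∫ ω, ((1 / 2) * ((X ω + u) ⬝ᵥ Z *ᵥ (X ω + u)) + ξ ⬝ᵥ (X ω + u)) ∂P =
      (1 / 2) * (u ⬝ᵥ Z *ᵥ u) + (Z *ᵥ (fun k => ∫ ω, X ω k ∂P) + ξ) ⬝ᵥ u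
        + ∫ ω, ((1 / 2) * (X ω ⬝ᵥ Z *ᵥ X ω) + ξ ⬝ᵥ X ω) ∂P := by
  have hint : ∀ k, Integrable (fun ω => X ω k) P := fun k => (hX k).integrable one_le_two
  have hdot : ∀ v : ι → ℝ, Integrable (fun ω => v ⬝ᵥ X ω) P := fun v =>
    integrable_finsetSum _ fun k _ => (hint k).const_mul (v k)
  have hdot_eq : ∀ v : ι → ℝ, ∫ ω, v ⬝ᵥ X ω ∂P = v ⬝ᵥ fun k => ∫ ω, X ω k ∂P := fun v => by
    simp only [dotProduct]
    rw [integral_finsetSum _ fun k _ => (hint k).const_mul (v k)]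
    simp only [integral_const_mul]
  have hquad : Integrable (fun ω => X ω ⬝ᵥ Z *ᵥ X ω) P := by
    simp only [dotProduct, mulVec, Finset.mul_sum]
    refine integrable_finsetSum _ fun k _ => integrable_finsetSum _ fun l _ => ?_
    refine (((hX k).integrable_mul (hX l)).const_mul (Z k l)).congr (.of_forall fun ω => ?_)
    simp only [Pi.mul_apply]
    ring
  have hsymm : ∀ v w : ι → ℝ, v ⬝ᵥ Z *ᵥ w = (Z *ᵥ v) ⬝ᵥ w := fun v w => by
    rw [dotProduct_mulVec, ← mulVec_transpose, hZ.eq]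
  have hexpand : ∀ ω, (1 / 2) * ((X ω + u) ⬝ᵥ Z *ᵥ (X ω + u)) + ξ ⬝ᵥ (X ω + u) =
      ((1 / 2) * (X ω ⬝ᵥ Z *ᵥ X ω) + ξ ⬝ᵥ X ω) +
        ((Z *ᵥ u) ⬝ᵥ X ω + ((1 / 2) * (u ⬝ᵥ Z *ᵥ u) + ξ ⬝ᵥ u)) := fun ω => by
    simp only [mulVec_add, dotProduct_add, add_dotProduct]
    rw [hsymm u (X ω), dotProduct_comm (X ω) (Z *ᵥ u)]
    ring
  have hleft : Integrable (fun ω => (1 / 2) * (X ω ⬝ᵥ Z *ᵥ X ω) + ξ ⬝ᵥ X ω) P :=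
    (hquad.const_mul _).add (hdot ξ)
  have hright : Integrable
      (fun ω => (Z *ᵥ u) ⬝ᵥ X ω + ((1 / 2) * (u ⬝ᵥ Z *ᵥ u) + ξ ⬝ᵥ u)) P :=
    (hdot _).add (integrable_const _)
  simp_rw [hexpand]
  rw [integral_add hleft hright,
    integral_add (hdot _) (integrable_const _), hdot_eq, integral_const, add_dotProduct,
    ← hsymm, dotProduct_comm u]
  simp only [probReal_univ, one_smul]
  ring

theorem memLp_affine_coord {Ω ι κ : Type*} [MeasurableSpace Ω] [Fintype κ] {P : Measure Ω}
    [IsFiniteMeasure P] {d : κ → Type*} [∀ j, Fintype (d j)] {q : ENNReal} (c : ι → ℝ)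
    (B : ∀ j, Matrix ι (d j) ℝ) (Y : ∀ j, Ω → d j → ℝ) (W : Ω → ι → ℝ)
    (hY : ∀ j l, MemLp (fun ω => Y j ω l) q P) (hW : ∀ k, MemLp (fun ω => W ω k) q P) (k : ι) :
    MemLp (fun ω => (c + ∑ j, B j *ᵥ Y j ω + W ω) k) q P := by
  simp only [Pi.add_apply, Finset.sum_apply, mulVec, dotProduct]
  have hsum : MemLp (fun ω => ∑ j, ∑ l, B j k l * Y j ω l) q P :=
    memLp_finsetSum _ fun j _ => memLp_finsetSum _ fun l _ => (hY j l).const_mul _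
  exact ((memLp_const (c k)).add hsum).add (hW k)

theorem integral_affine_coord {Ω ι κ : Type*} [MeasurableSpace Ω] [Fintype κ] {P : Measure Ω}
    [IsProbabilityMeasure P] {d : κ → Type*} [∀ j, Fintype (d j)] (c : ι → ℝ)
    (B : ∀ j, Matrix ι (d j) ℝ) (Y : ∀ j, Ω → d j → ℝ) (W : Ω → ι → ℝ)
    (hY : ∀ j l, Integrable (fun ω => Y j ω l) P) (hW : ∀ k, Integrable (fun ω => W ω k) P)
    (k : ι) :
    ∫ ω, (c + ∑ j, B j *ᵥ Y j ω + W ω) k ∂P =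
      (c + ∑ j, B j *ᵥ fun l => ∫ ω, Y j ω l ∂P) k + ∫ ω, W ω k ∂P := by
  simp only [Pi.add_apply, Finset.sum_apply, mulVec, dotProduct]
  have hterm : ∀ j l, Integrable (fun ω => B j k l * Y j ω l) P := fun j l =>
    (hY j l).const_mul _
  have hinner : ∀ j, Integrable (fun ω => ∑ l, B j k l * Y j ω l) P := fun j =>
    integrable_finsetSum _ fun l _ => hterm j l
  have hsum : Integrable (fun ω => ∑ j, ∑ l, B j k l * Y j ω l) P :=
    integrable_finsetSum _ fun j _ => hinner j
  have hconst_add : Integrable (fun ω => c k + ∑ j, ∑ l, B j k l * Y j ω l) P :=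
    (integrable_const _).add hsum
  rw [integral_add hconst_add (hW k), integral_add (integrable_const _) hsum, integral_const,
    integral_finsetSum _ fun j _ => hinner j]
  simp only [integral_finsetSum _ fun l _ => hterm _ l, integral_const_mul, probReal_univ,
    one_smul]

theorem HasMeanCov.memLp_coord {n : ℕ} {ν : Measure (EuclideanSpace ℝ (Fin n))}
    {μ : EuclideanSpace ℝ (Fin n)} {S : Matrix (Fin n) (Fin n) ℝ} (h : HasMeanCov ν μ S)
    (k : Fin n) : MemLp (fun x : EuclideanSpace ℝ (Fin n) => x k) 2 ν := by
  have hid : MemLp (fun x : EuclideanSpace ℝ (Fin n) => x) 2 ν :=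
    (memLp_two_iff_integrable_sq_norm h.1.aestronglyMeasurable).2 h.2.2.1
  exact hid.continuousLinearMap_comp (EuclideanSpace.proj (𝕜 := ℝ) k)

theorem HasMeanCov.integral_coord {n : ℕ} {ν : Measure (EuclideanSpace ℝ (Fin n))}
    {μ : EuclideanSpace ℝ (Fin n)} {S : Matrix (Fin n) (Fin n) ℝ} (h : HasMeanCov ν μ S)
    (k : Fin n) : ∫ x, x k ∂ν = μ k := by
  rw [← h.2.1]
  exact (EuclideanSpace.proj (𝕜 := ℝ) k).integral_comp_comm h.1

theorem MeasureTheory.MeasurePreserving.integral_comp_of_aestronglyMeasurable {α β : Type*}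
    [MeasurableSpace α] [MeasurableSpace β] {P : Measure α} {Q : Measure β} {f : α → β}
    (hf : MeasurePreserving f P Q) {g : β → ℝ} (hg : AEStronglyMeasurable g Q) :
    ∫ x, g (f x) ∂P = ∫ y, g y ∂Q := by
  rw [← hf.map_eq] at hg ⊢
  exact (integral_map hf.aemeasurable hg).symm

/-- **The averaged Q-function of a linear-quadratic Gaussian game is a convex quadratic in
the agent's own action.** With quadratic continuation value `(1/2) s'ᵀ Z s' + ξᵀ s'`,
quadratic action costs `R^{ij}`, fixed policies of the other agents (probability measures
`ν^j` with means `μ^j` and covariances `Σ^j`) and noise `ν_w` of mean `0` and covariance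
`I`, the averaged Q-function
`Q̄(a) = (1/2) aᵀ R^{ii} a + Σ_{j≠i} (1/2) ∫ a^{jᵀ} R^{ij} a^j dν^j
        + ∫ ((1/2) s'ᵀ Z s' + ξᵀ s') d(⊗_{j≠i} ν^j ⊗ ν_w)`,
where `s' = A s + B^i a + Σ_{j≠i} B^j a^j + w`, satisfies, for some constant `C`
independent of `a`,
`Q̄(a) = (1/2) aᵀ (R^{ii} + B^{iᵀ} Z B^i) a + bᵀ a + C` for all `a`, where
`b = B^{iᵀ} (Z (A s + Σ_{j≠i} B^j μ^j) + ξ)`. -/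
theorem averaged_Q_is_quadratic {n N : ℕ} (hn : 0 < n) (hN : 0 < N) (i : Fin N)
    (s : EuclideanSpace ℝ (Fin n)) (m : Fin N → ℕ)
    (A : Matrix (Fin n) (Fin n) ℝ)
    (B : ∀ j : Fin N, Matrix (Fin n) (Fin (m j)) ℝ)
    (Z : Matrix (Fin n) (Fin n) ℝ) (hZsymm : Z.IsSymm) (ξ : Fin n → ℝ)
    (R : ∀ j : Fin N, Matrix (Fin (m j)) (Fin (m j)) ℝ)
    (hRii : (R i).IsSymm) (hRij : ∀ j, j ≠ i → (R j).IsSymm)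
    (ν : ∀ j : {j : Fin N // j ≠ i}, Measure (EuclideanSpace ℝ (Fin (m j.1))))
    [∀ j, IsProbabilityMeasure (ν j)]
    (μ : ∀ j : {j : Fin N // j ≠ i}, EuclideanSpace ℝ (Fin (m j.1)))
    (S : ∀ j : {j : Fin N // j ≠ i}, Matrix (Fin (m j.1)) (Fin (m j.1)) ℝ)
    (hν : ∀ j, HasMeanCov (ν j) (μ j) (S j))
    (νw : Measure (EuclideanSpace ℝ (Fin n))) [IsProbabilityMeasure νw]
    (hνw : HasMeanCov νw 0 1) :
    ∃ C : ℝ, ∀ a : EuclideanSpace ℝ (Fin (m i)),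
      ((1 / 2) * (ev a ⬝ᵥ R i *ᵥ ev a)
        + ∑ j : {j : Fin N // j ≠ i},
            (1 / 2) * ∫ aj, ev aj ⬝ᵥ R j.1 *ᵥ ev aj ∂(ν j)
        + ∫ p : (∀ j : {j : Fin N // j ≠ i}, EuclideanSpace ℝ (Fin (m j.1))) ×
              EuclideanSpace ℝ (Fin n),
            ((1 / 2) * ((A *ᵥ ev s + B i *ᵥ ev a + ∑ j, B j.1 *ᵥ ev (p.1 j) + ev p.2) ⬝ᵥ
                Z *ᵥ (A *ᵥ ev s + B i *ᵥ ev a + ∑ j, B j.1 *ᵥ ev (p.1 j) + ev p.2))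
              + ξ ⬝ᵥ (A *ᵥ ev s + B i *ᵥ ev a + ∑ j, B j.1 *ᵥ ev (p.1 j) + ev p.2))
            ∂((Measure.pi ν).prod νw)) =
      (1 / 2) * (ev a ⬝ᵥ (R i + (B i)ᵀ * Z * B i) *ᵥ ev a)
        + ((B i)ᵀ *ᵥ (Z *ᵥ (A *ᵥ ev s + ∑ j : {j : Fin N // j ≠ i}, B j.1 *ᵥ ev (μ j)) + ξ))
            ⬝ᵥ ev a
        + C := by
  have hfst : ∀ j, MeasurePreserving
      (fun p : (∀ j : {j : Fin N // j ≠ i}, EuclideanSpace ℝ (Fin (m j.1))) ×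
        EuclideanSpace ℝ (Fin n) => p.1 j) ((Measure.pi ν).prod νw) (ν j) := fun j =>
    (measurePreserving_eval ν j).comp measurePreserving_fst
  have hsnd : MeasurePreserving
      (fun p : (∀ j : {j : Fin N // j ≠ i}, EuclideanSpace ℝ (Fin (m j.1))) ×
        EuclideanSpace ℝ (Fin n) => p.2) ((Measure.pi ν).prod νw) νw := measurePreserving_snd
  have hLp : ∀ j l, MemLp
      (fun p : (∀ j : {j : Fin N // j ≠ i}, EuclideanSpace ℝ (Fin (m j.1))) ×
        EuclideanSpace ℝ (Fin n) => p.1 j l) 2 ((Measure.pi ν).prod νw) := fun j l =>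
    ((hν j).memLp_coord l).comp_measurePreserving (hfst j)
  have hLpw : ∀ l, MemLp
      (fun p : (∀ j : {j : Fin N // j ≠ i}, EuclideanSpace ℝ (Fin (m j.1))) ×
        EuclideanSpace ℝ (Fin n) => p.2 l) 2 ((Measure.pi ν).prod νw) := fun l =>
    (hνw.memLp_coord l).comp_measurePreserving hsnd
  let X : (∀ j : {j : Fin N // j ≠ i}, EuclideanSpace ℝ (Fin (m j.1))) ×
      EuclideanSpace ℝ (Fin n) → Fin n → ℝ :=
    fun p => A *ᵥ ev s + ∑ j, B j.1 *ᵥ ev (p.1 j) + ev p.2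
  have hX := memLp_affine_coord (q := 2) (P := (Measure.pi ν).prod νw) (A *ᵥ ev s)
    (d := fun j : {j : Fin N // j ≠ i} => Fin (m j.1)) (fun j => B j.1)
    (fun j p => ev (p.1 j)) (fun p => ev p.2) hLp hLpw
  have hmean : (fun k => ∫ p, X p k ∂((Measure.pi ν).prod νw)) =
      A *ᵥ ev s + ∑ j : {j : Fin N // j ≠ i}, B j.1 *ᵥ ev (μ j) := by
    have hcoord : ∀ j l, ∫ p : (∀ j : {j : Fin N // j ≠ i}, EuclideanSpace ℝ (Fin (m j.1))) ×
        EuclideanSpace ℝ (Fin n), ev (p.1 j) l ∂((Measure.pi ν).prod νw) = ev (μ j) l :=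
      fun j l => ((hfst j).integral_comp_of_aestronglyMeasurable
        (g := fun x => x l) ((hν j).memLp_coord l).aestronglyMeasurable).trans
          ((hν j).integral_coord l)
    have hnoise : ∀ k, ∫ p : (∀ j : {j : Fin N // j ≠ i}, EuclideanSpace ℝ (Fin (m j.1))) ×
        EuclideanSpace ℝ (Fin n), ev p.2 k ∂((Measure.pi ν).prod νw) = 0 :=
      fun k => (hsnd.integral_comp_of_aestronglyMeasurable
        (g := fun x => x k) (hνw.memLp_coord k).aestronglyMeasurable).trans
          (hνw.integral_coord k)
    funext k
    have haffine := integral_affine_coord (P := (Measure.pi ν).prod νw) (A *ᵥ ev s)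
      (d := fun j : {j : Fin N // j ≠ i} => Fin (m j.1)) (fun j => B j.1)
      (fun j p => ev (p.1 j)) (fun p => ev p.2) (fun j l => (hLp j l).integrable one_le_two)
      (fun l => (hLpw l).integrable one_le_two) k
    refine haffine.trans ?_
    simp only [hcoord, hnoise, add_zero, Pi.add_apply]
  refine ⟨(∑ j : {j : Fin N // j ≠ i}, (1 / 2) * ∫ aj, ev aj ⬝ᵥ R j.1 *ᵥ ev aj ∂(ν j)) +
    ∫ p, ((1 / 2) * (X p ⬝ᵥ Z *ᵥ X p) + ξ ⬝ᵥ X p) ∂((Measure.pi ν).prod νw), fun a => ?_⟩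
  have hs' : ∀ p : (∀ j : {j : Fin N // j ≠ i}, EuclideanSpace ℝ (Fin (m j.1))) ×
      EuclideanSpace ℝ (Fin n),
      A *ᵥ ev s + B i *ᵥ ev a + ∑ j, B j.1 *ᵥ ev (p.1 j) + ev p.2 = X p + B i *ᵥ ev a :=
    fun p => by simp only [X]; abel
  simp only [hs']
  rw [integral_quadratic_translate _ X hX Z hZsymm, hmean, add_mulVec, dotProduct_add,
    mulVec_transpose (B i), ← dotProduct_mulVec]
  have hquad : ev a ⬝ᵥ ((B i)ᵀ * Z * B i) *ᵥ ev a =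
      (B i *ᵥ ev a) ⬝ᵥ Z *ᵥ (B i *ᵥ ev a) := by
    rw [← mulVec_mulVec, ← mulVec_mulVec, dotProduct_mulVec, vecMul_transpose]
  rw [hquad]
  ring
end
end
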